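/- Let p and q be odd primes with p dividing q−1, let G be a finite non-abelian group of order pq with commutator subgroup G' = [G,G] (so |G'| = q), and let S be a minimal product-one sequence over G with |S| ≥ 2q + 1. Then the number of terms of S lying in G' is at most (q − 3)/2. -/

import Mathlib

/-- The set of all products of the terms of the multiset `S` taken in some order. -/
def prodSet {G : Type*} [Group G] (S : Multiset G) : Set G :=
  {g | ∃ l : List G, (l : Multiset G) = S ∧ l.prod = g}

/-- A sequence (multiset) over `G` is a product-one sequence if its terms can be
ordered so that their product is `1`. -/
def IsProductOne {G : Type*} [Group G] (S : Multiset G) : Prop :=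
  (1 : G) ∈ prodSet S

/-- A minimal product-one sequence (atom): a nontrivial product-one sequence that cannot
be partitioned into two nontrivial product-one subsequences. -/
def IsMinimalProductOne {G : Type*} [Group G] (S : Multiset G) : Prop :=
  S ≠ 0 ∧ IsProductOne S ∧
    ¬ ∃ T₁ T₂ : Multiset G, T₁ ≠ 0 ∧ T₂ ≠ 0 ∧ S = T₁ + T₂ ∧
      IsProductOne T₁ ∧ IsProductOne T₂

/-- The small Davenport constant: the maximal length of a sequence over `G` having
no nontrivial product-one subsequence. -/
noncomputable def smallDavenport (G : Type*) [Group G] : ℕ :=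
  sSup {n | ∃ S : Multiset G, Multiset.card S = n ∧
    ∀ T : Multiset G, T ≤ S → T ≠ 0 → ¬ IsProductOne T}

/-- The large Davenport constant: the maximal length of a minimal product-one sequence. -/
noncomputable def largeDavenport (G : Type*) [Group G] : ℕ :=
  sSup {n | ∃ S : Multiset G, Multiset.card S = n ∧ IsMinimalProductOne S}

/-- In a non-abelian group of order `p * q` with `p < q` prime, the commutator subgroup is
the subgroup of order `q`. -/
lemma card_commutator_of_card_eq_mul_prime {p q : ℕ} (hp : p.Prime) (hq : q.Prime) (hlt : p < q)
    {G : Type*} [Group G] [Finite G] (hG : Nat.card G = p * q)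
    (hna : ¬ ∀ a b : G, a * b = b * a) : Nat.card (commutator G) = q := by
  have : Fact q.Prime := ⟨hq⟩
  have : Fact p.Prime := ⟨hp⟩
  obtain ⟨u, hu⟩ := exists_prime_orderOf_dvd_card' (G := G) q (hG ▸ dvd_mul_left q p)
  let Q := Subgroup.zpowers u
  have hQ : Nat.card Q = q := by rw [Nat.card_zpowers, hu]
  have hQi : Q.index = p := by
    have := Q.card_mul_index
    rw [hG, hQ, mul_comm p q] at this
    exact Nat.eq_of_mul_eq_mul_left hq.pos this
  have hnorm : Q.Normal := by
    apply Subgroup.normal_of_index_eq_minFac_card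
    have hne : p * q ≠ 1 := by simp [hp.ne_one]
    rw [hQi, hG]
    refine le_antisymm ?_ (Nat.minFac_le_of_dvd hp.two_le (dvd_mul_right p q))
    rcases (Nat.minFac_prime hne).dvd_mul.mp (Nat.minFac_dvd _) with h | h
    · exact ((Nat.prime_dvd_prime_iff_eq (Nat.minFac_prime hne) hp).mp h).ge
    · exact hlt.le.trans ((Nat.prime_dvd_prime_iff_eq (Nat.minFac_prime hne) hq).mp h).ge
  have hcyc : IsCyclic (G ⧸ Q) := isCyclic_of_prime_card (p := p) hQi
  have hle : commutator G ≤ Q :=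
    Subgroup.Normal.quotient_commutative_iff_commutator_le.mp inferInstance
  have hdvd : Nat.card (commutator G) ∣ q := hQ ▸ Subgroup.card_dvd_of_le hle
  rcases (Nat.dvd_prime hq).mp hdvd with h | h
  · refine absurd (fun a b => ?_) hna
    have := Subgroup.card_eq_one.mp h
    rw [commutator_def, Subgroup.commutator_eq_bot_iff_le_centralizer] at this
    exact (this (Subgroup.mem_top b) a (Subgroup.mem_top a))
  · exact h

/-- A non-abelian group of order `p * q` embeds in the affine group of `ZMod q`: `r` is the linear
part, `x` the translation part, and the commutator subgroup is the group of translations. -/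
lemma exists_affine_coordinates {p q : ℕ} (hp : p.Prime) (hq : q.Prime) (hlt : p < q)
    {G : Type*} [Group G] [Finite G] (hG : Nat.card G = p * q)
    (hna : ¬ ∀ a b : G, a * b = b * a) :
    ∃ (r : G →* ZMod q) (x : G → ZMod q), (∀ g h, x (g * h) = x g + r g * x h) ∧
      (∀ g, r g = 1 ↔ g ∈ commutator G) ∧ (∀ g, r g = 1 → x g = 0 → g = 1) ∧
      ∀ g, r g ^ p = 1 := by
  have : Fact q.Prime := ⟨hq⟩
  have : Fact p.Prime := ⟨hp⟩
  have hN := card_commutator_of_card_eq_mul_prime hp hq hlt hG hna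
  have hNi : (commutator G).index = p := by
    have := (commutator G).card_mul_index
    rw [hG, hN, mul_comm p q] at this
    exact Nat.eq_of_mul_eq_mul_left hq.pos this
  let e : commutator G ≃* Multiplicative (ZMod q) := mulEquivOfPrimeCardEq (p := q) hN (by simp)
  obtain ⟨r, hφ⟩ : ∃ r : G →* ZMod q, ∀ (g : G) (n : commutator G),
      (e (MulAut.conjNormal g n)).toAdd = r g * (e n).toAdd := by
    let φ : G → ZMod q →+ ZMod q := fun g => AddMonoidHom.mk'
      (fun z => (e (MulAut.conjNormal g (e.symm (Multiplicative.ofAdd z)))).toAdd)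
      (by intro a b; simp [ofAdd_add])
    have hφ (g : G) (n : commutator G) :
        (e (MulAut.conjNormal g n)).toAdd = φ g 1 * (e n).toAdd := by
      have h := ZMod.map_smul (φ g) (e n).toAdd 1
      simp only [smul_eq_mul, mul_one] at h
      rw [mul_comm, ← h]
      simp [φ]
    let r : G →* ZMod q :=
      { toFun := fun g => φ g 1
        map_one' := by simp [φ]
        map_mul' := fun g h => by
          rw [← mul_one (φ h 1)]
          have := hφ g (MulAut.conjNormal h (e.symm (Multiplicative.ofAdd 1)))
          simp only [hφ h] at this
          simpa [φ] using this }
    exact ⟨r, hφ⟩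
  have hcomm (m n : commutator G) : m * n = n * m :=
    e.injective (by rw [map_mul, map_mul, mul_comm])
  have hr_of_mem (g : G) (hg : g ∈ commutator G) : r g = 1 := by
    have h := hφ g (e.symm (Multiplicative.ofAdd 1))
    have h2 : MulAut.conjNormal g (e.symm (Multiplicative.ofAdd 1)) =
        e.symm (Multiplicative.ofAdd 1) := by
      apply Subtype.ext
      rw [MulAut.conjNormal_apply]
      have := congrArg Subtype.val (hcomm ⟨g, hg⟩ (e.symm (Multiplicative.ofAdd 1)))
      simp only [Subgroup.coe_mul] at this
      rw [this, mul_inv_cancel_right]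
    rw [h2] at h
    simpa using h.symm
  let R : G →* (ZMod q)ˣ := r.toHomUnits
  have hR (g : G) : R g = 1 ↔ r g = 1 := by
    rw [← Units.val_inj]; simp [R]
  have hker : commutator G ≤ R.ker := fun g hg => (hR g).mpr (hr_of_mem g hg)
  have hexists : ∃ b, r b ≠ 1 := by
    by_contra! hall
    apply hna
    have hcyc : IsCyclic (G ⧸ commutator G) := isCyclic_of_prime_card (p := p) hNi
    have := (QuotientGroup.mk' (commutator G)).isMulCommutative_of_isCyclic_of_ker_le_center (by
      rw [QuotientGroup.ker_mk']
      intro n hn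
      rw [Subgroup.mem_center_iff]
      intro g
      have h := hφ g ⟨n, hn⟩
      rw [hall g, one_mul] at h
      have h2 := congrArg Subtype.val (e.injective (Multiplicative.toAdd.injective h))
      rw [MulAut.conjNormal_apply] at h2
      exact mul_inv_eq_iff_eq_mul.mp h2)
    exact fun a b => this.is_comm.comm a b
  obtain ⟨b, hb⟩ := hexists
  have hr_iff (g : G) : r g = 1 ↔ g ∈ commutator G := by
    refine ⟨fun h => ?_, hr_of_mem g⟩
    have hidx : R.ker.index ∣ p := hNi ▸ Subgroup.index_dvd_of_le hker
    have hkc : R.ker = commutator G := by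
      rcases (Nat.dvd_prime hp).mp hidx with h1 | h1
      · rw [Subgroup.index_eq_one] at h1
        exact absurd ((hR b).mp (h1 ▸ Subgroup.mem_top b : b ∈ R.ker)) hb
      · refine (Subgroup.eq_of_le_of_card_ge hker ?_).symm
        have h2 := R.ker.card_mul_index
        rw [h1, hG, mul_comm] at h2
        rw [hN, Nat.eq_of_mul_eq_mul_left hp.pos h2]
    exact hkc ▸ (hR g).mpr h
  have hmem (g : G) : g * b * g⁻¹ * b⁻¹ ∈ commutator G :=
    Subgroup.commutator_mem_commutator (Subgroup.mem_top g) (Subgroup.mem_top b)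
  refine ⟨r, fun g => (e ⟨g * b * g⁻¹ * b⁻¹, hmem g⟩).toAdd, ?_, hr_iff, ?_, ?_⟩
  · intro g h
    have h1 : (⟨g * h * b * (g * h)⁻¹ * b⁻¹, hmem (g * h)⟩ : commutator G) =
        MulAut.conjNormal g ⟨h * b * h⁻¹ * b⁻¹, hmem h⟩ * ⟨g * b * g⁻¹ * b⁻¹, hmem g⟩ := by
      apply Subtype.ext
      simp only [Subgroup.coe_mul, MulAut.conjNormal_apply]
      group
    beta_reduce
    rw [h1, map_mul, toAdd_mul, hφ, add_comm]
  · intro g hg hx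
    have hgN := (hr_iff g).mp hg
    have h1 : (⟨g * b * g⁻¹ * b⁻¹, hmem g⟩ : commutator G) =
        ⟨g, hgN⟩ * MulAut.conjNormal b (⟨g, hgN⟩⁻¹) := by
      apply Subtype.ext
      simp [MulAut.conjNormal_apply, mul_assoc]
    beta_reduce at hx
    rw [h1, map_mul, toAdd_mul, hφ] at hx
    have h2 : (1 - r b) * (e ⟨g, hgN⟩).toAdd = 0 := by
      rw [map_inv, toAdd_inv] at hx
      linear_combination hx
    rcases mul_eq_zero.mp h2 with h3 | h3
    · exact absurd (sub_eq_zero.mp h3).symm hb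
    · have h4 : e ⟨g, hgN⟩ = 1 := by simpa using h3
      simpa using congrArg Subtype.val ((map_eq_one_iff e e.injective).mp h4)
  · intro g
    rw [← map_pow, hr_iff, ← hNi]
    exact Subgroup.pow_index_mem _ g

section OrderedSubproduct

variable {G K : Type*} [Group G] [Field K]

/-- The operator `f ↦ f - r(g)^(E+1) f(g ·)` applied for `g` running through a list, with `E`
increasing by one at each step. -/
def subtractTranslates (r : G →* K) : List G → ℕ → (G → K) →ₗ[K] (G → K)
  | [], _ => LinearMap.id
  | g :: l, E => subtractTranslates r l (E + 1) ∘ₗ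
      (LinearMap.id - r g ^ (E + 1) • LinearMap.funLeft K K (g * ·))

lemma subtractTranslates_cons_apply (r : G →* K) (g : G) (l : List G) (E : ℕ) (f : G → K) :
    subtractTranslates r (g :: l) E f =
      subtractTranslates r l (E + 1) (fun h => f h - r g ^ (E + 1) * f (g * h)) := rfl

lemma subtractTranslates_apply_one (r : G →* K) (l : List G) (E : ℕ) (f : G → K)
    (hf : ∀ t, t.Sublist l → t ≠ [] → f t.prod = 0) :
    subtractTranslates r l E f 1 = f 1 := by
  induction l generalizing E f with
  | nil => rfl
  | cons g l ih =>
    rw [subtractTranslates_cons_apply, ih]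
    · have := hf [g] (by simp) (by simp)
      simp at this
      simp [this]
    · intro t ht hne
      have h1 := hf t (ht.cons g) hne
      have h2 := hf (g :: t) (ht.cons_cons g) (by simp)
      rw [List.prod_cons] at h2
      simp [h1, h2]

open Polynomial in
lemma degree_sub_C_mul_comp_lt {P : K[X]} {d : ℕ} (hP : P.degree < (d + 1 : ℕ)) {b s c : K}
    (hc : c * s ^ d = 1) : (P - C c * P.comp (C s * X + C b)).degree < d := by
  have hs : (C s * X + C b : K[X]).natDegree ≤ 1 := natDegree_linear_le
  rw [degree_lt_iff_coeff_zero] at hP ⊢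
  have hPd : P.natDegree ≤ d := by
    rw [natDegree_le_iff_coeff_eq_zero]
    exact fun N hN => hP N hN
  have hcomp : (P.comp (C s * X + C b)).natDegree ≤ d :=
    natDegree_comp_le.trans ((Nat.mul_le_mul hPd hs).trans (mul_one d).le)
  intro m hm
  rcases hm.eq_or_lt with rfl | hm
  · have : (P.comp (C s * X + C b)).coeff d = P.coeff d * s ^ d := by
      rw [comp, eval₂_eq_sum_range' C (Nat.lt_succ_of_le hPd), finsetSum_coeff,
        Finset.sum_range_succ, Finset.sum_eq_zero, zero_add, coeff_C_mul]
      · congr 1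
        have := coeff_pow_of_natDegree_le hs (n := 1) (m := d)
        simpa using this
      · intro i hi
        rw [coeff_C_mul, coeff_eq_zero_of_natDegree_lt (p := (C s * X + C b) ^ i), mul_zero]
        calc _ ≤ i * 1 := natDegree_pow_le_of_le i hs
          _ < d := by simpa using hi
    rw [coeff_sub, coeff_C_mul, this]
    linear_combination -P.coeff d * hc
  · rw [coeff_sub, coeff_C_mul, hP m hm, coeff_eq_zero_of_natDegree_lt (hcomp.trans_lt hm)]
    simp

open Polynomial in
lemma subtractTranslates_eq_zero (r : G →* K) (x : G → K)
    (hx : ∀ g h, x (g * h) = x g + r g * x h) {p : ℕ} (hr : ∀ g, r g ^ p = 1) (m : ℕ)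
    (l : List G) (E d w : ℕ) (P : K[X]) (hP : P.degree < d) (hl : d + w ≤ l.length)
    (hdvd : p ∣ E + m + d + w) :
    subtractTranslates r l E (fun h => r h ^ m * P.eval (x h)) = 0 := by
  induction l generalizing E d w P with
  | nil =>
    obtain rfl : d = 0 := by simp at hl; omega
    have : P = 0 := by simpa using hP
    subst this
    simp [← Pi.zero_def]
  | cons g l ih =>
    rw [subtractTranslates_cons_apply]
    let Q := P - C (r g ^ (E + 1 + m)) * P.comp (C (r g) * X + C (x g))
    have hQ : (fun h => r h ^ m * P.eval (x h) -
        r g ^ (E + 1) * (r (g * h) ^ m * P.eval (x (g * h)))) =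
        fun h => r h ^ m * Q.eval (x h) := by
      funext h
      simp only [Q, map_mul, hx, eval_sub, eval_mul, eval_C, eval_comp, eval_add, eval_X]
      rw [add_comm (x g)]
      ring
    rw [hQ]
    simp only [List.length_cons] at hl
    rcases d with _ | d
    · have hP0 : P = 0 := by simpa using hP
      have : Q = 0 := by simp [Q, hP0]
      rw [this]
      simp [← Pi.zero_def]
    · rcases w with _ | w
      · refine ih (E + 1) d 0 Q (degree_sub_C_mul_comp_lt hP ?_) (by omega)
          (by convert hdvd using 1; ring)
        rw [← pow_add]
        obtain ⟨k, hk⟩ := hdvd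
        rw [show E + 1 + m + d = p * k by omega, pow_mul, hr, one_pow]
      · refine ih (E + 1) (d + 1) w Q ?_ (by omega) (by convert hdvd using 1; ring)
        refine (degree_sub_le _ _).trans_lt (max_lt hP ?_)
        rw [degree_lt_iff_coeff_zero] at hP ⊢
        have hPd : P.natDegree ≤ d := by
          rw [natDegree_le_iff_coeff_eq_zero]
          exact fun N hN => hP N hN
        intro n hn
        rw [coeff_C_mul, coeff_eq_zero_of_natDegree_lt, mul_zero]
        calc _ ≤ d * 1 := natDegree_comp_le.trans (Nat.mul_le_mul hPd natDegree_linear_le)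
          _ < n := by omega

end OrderedSubproduct

open Polynomial in
/-- In a group of affine maps of `ZMod q` whose linear parts have order dividing `p`, every list of
length at least `p + q - 1` has a nonempty sublist with product one. -/
lemma exists_sublist_prod_eq_one {p q : ℕ} (hp : p.Prime) (hq : q.Prime) (hlt : p < q)
    {G : Type*} [Group G] (r : G →* ZMod q) (x : G → ZMod q)
    (hx : ∀ g h, x (g * h) = x g + r g * x h) (hinj : ∀ g, r g = 1 → x g = 0 → g = 1)
    (hr : ∀ g, r g ^ p = 1) (l : List G) (hl : p + q - 1 ≤ l.length) :
    ∃ t, t.Sublist l ∧ t ≠ [] ∧ t.prod = 1 := by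
  have : Fact q.Prime := ⟨hq⟩
  by_contra! hcon
  have hx1 : x 1 = 0 := by simpa using hx 1 1
  let P : (ZMod q)[X] := 1 - X ^ (q - 1)
  let δ : G → ZMod q := ∑ m ∈ Finset.range p, fun h => r h ^ m * P.eval (x h)
  have hP : P.degree < (q : ℕ) := by
    have h1 : (1 : (ZMod q)[X]).degree < (q : ℕ) := by
      rw [degree_one]; exact_mod_cast hq.pos
    refine (degree_sub_le _ _).trans_lt (max_lt h1 ?_)
    rw [degree_X_pow]
    exact_mod_cast Nat.sub_lt hq.pos one_pos
  have hzero : subtractTranslates r l 0 δ = 0 := by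
    rw [map_sum]
    refine Finset.sum_eq_zero fun m _ => ?_
    have hmod := Nat.mod_lt (m + q) hp.pos
    rcases Nat.eq_zero_or_pos ((m + q) % p) with h0 | h0
    · refine subtractTranslates_eq_zero r x hx hr m l 0 q 0 P hP (by omega) ?_
      simpa using Nat.dvd_of_mod_eq_zero h0
    · refine subtractTranslates_eq_zero r x hx hr m l 0 q (p - (m + q) % p) P hP (by omega) ?_
      rw [zero_add, ← Nat.add_sub_assoc hmod.le]
      refine ⟨(m + q) / p + 1, ?_⟩
      have := Nat.div_add_mod (m + q) p
      rw [mul_add]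
      omega
  have hδ (h : G) (hh : h ≠ 1) : δ h = 0 := by
    simp only [δ, Finset.sum_apply, ← Finset.sum_mul]
    by_cases hrh : r h = 1
    · have hxh : x h ≠ 0 := fun hxh => hh (hinj h hrh hxh)
      simp [P, ZMod.pow_card_sub_one_eq_one hxh]
    · have h1 := mul_geom_sum (r h) p
      rw [hr, sub_self] at h1
      rw [(mul_eq_zero.mp h1).resolve_left (sub_ne_zero.mpr hrh), zero_mul]
  have h1 := subtractTranslates_apply_one r l 0 δ fun t ht hne => hδ _ (hcon t ht hne)
  rw [hzero] at h1
  have h2 : δ 1 = p := by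
    simp [δ, P, hx1, Nat.sub_ne_zero_of_lt hq.one_lt]
  rw [h2, Pi.zero_apply] at h1
  exact Nat.not_dvd_of_pos_of_lt hp.pos hlt ((ZMod.natCast_eq_zero_iff p q).mp h1.symm)

lemma translation_one {G K : Type*} [Group G] [Field K] {r : G →* K} {x : G → K}
    (hx : ∀ g h, x (g * h) = x g + r g * x h) : x 1 = 0 := by
  simpa using hx 1 1

/-- On lists of translations, the linear part of the product is `1` and the translation part is
additive. -/
lemma linear_prod_of_translations {G K : Type*} [Group G] [Field K] {r : G →* K} (l : List G)
    (hl : ∀ g ∈ l, r g = 1) : r l.prod = 1 := by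
  rw [map_list_prod]
  refine List.prod_eq_one fun y hy => ?_
  obtain ⟨g, hg, rfl⟩ := List.mem_map.mp hy
  exact hl g hg

lemma translation_prod_of_translations {G K : Type*} [Group G] [Field K] {r : G →* K} {x : G → K}
    (hx : ∀ g h, x (g * h) = x g + r g * x h) (l : List G)
    (hl : ∀ g ∈ l, r g = 1) : x l.prod = (l.map x).sum := by
  induction l with
  | nil => simpa using translation_one hx
  | cons g l ih =>
    rw [List.prod_cons, hx, hl g (by simp), ih fun h hh => hl h (by simp [hh])]
    simp

/-- Nonzero elements of `ZMod q`, each dilated by one of three multipliers, have at least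
`min q (c * n + 1)` distinct sums when there are `c + 1` distinct multipliers. -/
lemma exists_dilated_sums {q : ℕ} (hq : q.Prime) {G : Type*} (x : G → ZMod q)
    (a b c : ZMod q) (T : List G) (hT : ∀ g ∈ T, x g ≠ 0) :
    ∃ F : Finset (ZMod q),
      min q (T.length * (({a, b, c} : Finset (ZMod q)).card - 1) + 1) ≤ F.card ∧
      ∀ y ∈ F, ∃ A B C : List G, (A ++ B ++ C).Perm T ∧
        y = a * (A.map x).sum + b * (B.map x).sum + c * (C.map x).sum := by
  have : Fact q.Prime := ⟨hq⟩
  induction T with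
  | nil =>
    refine ⟨{0}, by simp, fun y hy => ⟨[], [], [], by simp, by simpa using hy⟩⟩
  | cons g T ih =>
    obtain ⟨F, hF, hrep⟩ := ih fun h hh => hT h (by simp [hh])
    have hg : x g ≠ 0 := hT g (by simp)
    let M : Finset (ZMod q) := ({a, b, c} : Finset (ZMod q)).image (· * x g)
    have hM : M.card = ({a, b, c} : Finset (ZMod q)).card :=
      Finset.card_image_of_injective _ (mul_left_injective₀ hg)
    have hMpos : 0 < ({a, b, c} : Finset (ZMod q)).card := Finset.card_pos.mpr (by simp)
    have hFne : F.Nonempty := by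
      rw [← Finset.card_pos]
      exact lt_of_lt_of_le (lt_min hq.pos (Nat.succ_pos _)) hF
    open scoped Pointwise in
    refine ⟨F + M, ?_, ?_⟩
    · refine le_trans ?_ (ZMod.cauchy_davenport hq hFne (Finset.card_pos.mp (hM ▸ hMpos)))
      rw [hM, List.length_cons, Nat.succ_mul]
      omega
    · intro y hy
      obtain ⟨u, hu, v, hv, rfl⟩ := Finset.mem_add.mp hy
      obtain ⟨A, B, C, hperm, rfl⟩ := hrep u hu
      obtain ⟨k, hk, rfl⟩ := Finset.mem_image.mp hv
      simp only [Finset.mem_insert, Finset.mem_singleton] at hk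
      rcases hk with rfl | rfl | rfl
      · refine ⟨g :: A, B, C, by simpa using hperm, ?_⟩
        simp; ring
      · refine ⟨A, g :: B, C, ?_, ?_⟩
        · refine List.Perm.trans ?_ (hperm.cons g)
          simp
        · simp; ring
      · refine ⟨A, B, g :: C, ?_, ?_⟩
        · exact List.perm_middle.trans (hperm.cons g)
        · simp; ring

/-- Sufficiently many translations can be distributed around `w₁` and `w₂` so as to turn any
sequence whose linear parts multiply to one into a product-one sequence. -/
lemma isProductOne_of_many_translations {q : ℕ} (hq : q.Prime) {G : Type*} [Group G]
    (r : G →* ZMod q) (x : G → ZMod q) (hx : ∀ g h, x (g * h) = x g + r g * x h)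
    (hinj : ∀ g, r g = 1 → x g = 0 → g = 1) (w₁ w₂ : G) (T U : Multiset G)
    (hT : ∀ g ∈ T, r g = 1 ∧ g ≠ 1)
    (hr : ((w₁ ::ₘ w₂ ::ₘ (T + U)).map r).prod = 1)
    (hcard : q ≤ T.card * (({1, r w₁, r w₁ * r w₂} : Finset (ZMod q)).card - 1) + 1) :
    IsProductOne (w₁ ::ₘ w₂ ::ₘ (T + U)) := by
  have : Fact q.Prime := ⟨hq⟩
  induction T using Quotient.inductionOn with | _ T =>
  induction U using Quotient.inductionOn with | _ U =>
  simp only [Multiset.quot_mk_to_coe, Multiset.coe_card, Multiset.mem_coe] at *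
  obtain ⟨F, hF, hrep⟩ := exists_dilated_sums hq x 1 (r w₁) (r w₁ * r w₂) T
    fun g hg hxg => (hT g hg).2 (hinj g (hT g hg).1 hxg)
  have hFuniv : F = Finset.univ := by
    rw [← Finset.card_eq_iff_eq_univ, ZMod.card]
    refine le_antisymm ?_ ((le_min le_rfl hcard).trans hF)
    simpa [ZMod.card] using F.card_le_univ
  obtain ⟨A, B, C, hperm, hy⟩ := hrep (-(x w₁ + r w₁ * x w₂ + r w₁ * r w₂ * x U.prod))
    (hFuniv ▸ Finset.mem_univ _)
  have hABC (g : G) (hg : g ∈ A ++ B ++ C) : r g = 1 := (hT g (hperm.subset hg)).1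
  have hA : ∀ g ∈ A, r g = 1 := fun g hg => hABC g (by simp [hg])
  have hB : ∀ g ∈ B, r g = 1 := fun g hg => hABC g (by simp [hg])
  have hC : ∀ g ∈ C, r g = 1 := fun g hg => hABC g (by simp [hg])
  have hLS : ((A ++ w₁ :: (B ++ w₂ :: (C ++ U)) : List G) : Multiset G) =
      w₁ ::ₘ w₂ ::ₘ ((T : Multiset G) + (U : Multiset G)) := by
    rw [← Multiset.coe_eq_coe.mpr hperm]
    simp only [← Multiset.coe_add, ← Multiset.cons_coe, Multiset.add_cons, add_assoc]
  refine ⟨_, hLS, hinj _ ?_ ?_⟩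
  · rw [← hLS, Multiset.map_coe, Multiset.prod_coe] at hr
    rw [map_list_prod, hr]
  · simp only [List.prod_append, List.prod_cons, hx,
      translation_prod_of_translations hx _ hA, translation_prod_of_translations hx _ hB,
      translation_prod_of_translations hx _ hC, linear_prod_of_translations _ hA,
      linear_prod_of_translations _ hB, linear_prod_of_translations _ hC]
    linear_combination -hy

lemma Multiset.exists_le_card_eq_of_le_card {α : Type*} {s : Multiset α} {n : ℕ}
    (h : n ≤ s.card) : ∃ t ≤ s, t.card = n := by
  refine ⟨s.toList.take n, ?_, by simpa using h⟩
  conv_rhs => rw [← s.coe_toList]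
  exact (List.take_sublist n s.toList).subperm

lemma exists_pair_mul_ne_one {G K : Type*} [Field K] (r : G → K) {p : ℕ} (hpodd : Odd p)
    (hr : ∀ g, r g ^ p = 1) (W : Multiset G) (hW : ∀ g ∈ W, r g ≠ 1) (hcard : 3 ≤ W.card) :
    ∃ w₁ w₂ V, W = w₁ ::ₘ w₂ ::ₘ V ∧ r w₁ * r w₂ ≠ 1 := by
  obtain ⟨Y, hYW, hY⟩ := Multiset.exists_le_card_eq_of_le_card hcard
  obtain ⟨a, b, c, rfl⟩ := Multiset.card_eq_three.mp hY
  obtain ⟨W, rfl⟩ := Multiset.le_iff_exists_add.mp hYW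
  simp only [Multiset.insert_eq_cons, Multiset.cons_add, Multiset.singleton_add] at *
  by_contra! hcon
  have hab := hcon a b _ rfl
  have hac := hcon a c (b ::ₘ W) (by rw [Multiset.cons_swap b c])
  have hbc := hcon b c (a ::ₘ W) (by rw [Multiset.cons_swap a b, Multiset.cons_swap a c])
  apply hW a (by simp)
  have hsq : r a ^ 2 = 1 := by
    calc r a ^ 2 = r a ^ 2 * (r b * r c) := by rw [hbc, mul_one]
      _ = (r a * r b) * (r a * r c) := by ring
      _ = 1 := by rw [hab, hac, mul_one]
  obtain ⟨k, rfl⟩ := hpodd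
  simpa [pow_succ, pow_mul, hsq] using hr a

lemma prod_map_eq_one_of_isProductOne {G K : Type*} [Group G] [Field K] (r : G →* K)
    {S : Multiset G} (hS : IsProductOne S) : (S.map r).prod = 1 := by
  obtain ⟨l, rfl, hl⟩ := hS
  rw [Multiset.map_coe, Multiset.prod_coe, ← map_list_prod, hl, map_one]

lemma IsMinimalProductOne.one_notMem {G : Type*} [Group G] {S : Multiset G}
    (hS : IsMinimalProductOne S) (hcard : 2 ≤ S.card) : (1 : G) ∉ S := by
  intro h
  obtain ⟨-, ⟨l, rfl, hl⟩, hmin⟩ := hS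
  obtain ⟨s, t, rfl⟩ := List.append_of_mem (Multiset.mem_coe.mp h)
  refine hmin ⟨{1}, ((s ++ t : List G) : Multiset G), by simp, ?_, ?_, ⟨[1], by simp⟩,
    ⟨s ++ t, rfl, by simpa using hl⟩⟩
  · intro h0
    simp only [Multiset.coe_eq_zero, List.append_eq_nil_iff] at h0
    simp [h0.1, h0.2] at hcard
  · rw [Multiset.singleton_add, Multiset.cons_coe, Multiset.coe_eq_coe]
    exact List.perm_middle

/-- `S` is not minimal if a product-one subsequence can be removed leaving two non-translations and
sufficiently many translations. -/
lemma not_isMinimalProductOne_of_many_translations {q : ℕ} (hq : q.Prime) {G : Type*} [Group G]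
    (r : G →* ZMod q) (x : G → ZMod q) (hx : ∀ g h, x (g * h) = x g + r g * x h)
    (hinj : ∀ g, r g = 1 → x g = 0 → g = 1) (w₁ w₂ : G) (T U X : Multiset G)
    (hT : ∀ g ∈ T, r g = 1)
    (hcard : q ≤ T.card * (({1, r w₁, r w₁ * r w₂} : Finset (ZMod q)).card - 1) + 1)
    (hX : X ≠ 0) (hXone : IsProductOne X) :
    ¬ IsMinimalProductOne (w₁ ::ₘ w₂ ::ₘ (T + U) + X) := by
  have : Fact q.Prime := ⟨hq⟩
  intro hS
  have hone := hS.one_notMem (by simp)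
  refine hS.2.2 ⟨_, X, by simp, hX, rfl, ?_, hXone⟩
  refine isProductOne_of_many_translations hq r x hx hinj w₁ w₂ T U
    (fun g hg => ⟨hT g hg, ?_⟩) ?_ hcard
  · rintro rfl
    exact hone (by simp [hg])
  · have h := prod_map_eq_one_of_isProductOne r hS.2.1
    rwa [Multiset.map_add, Multiset.prod_add, prod_map_eq_one_of_isProductOne r hXone,
      mul_one] at h

lemma isProductOne_of_translations {G K : Type*} [Group G] [Field K]
    {r : G →* K} {x : G → K} (hx : ∀ g h, x (g * h) = x g + r g * x h)
    (hinj : ∀ g, r g = 1 → x g = 0 → g = 1) (T : Multiset G) (hT : ∀ g ∈ T, r g = 1)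
    (hsum : (T.map x).sum = 0) : IsProductOne T := by
  induction T using Quotient.inductionOn with | _ l =>
  simp only [Multiset.quot_mk_to_coe, Multiset.mem_coe, Multiset.map_coe,
    Multiset.sum_coe] at *
  exact ⟨l, rfl, hinj _ (linear_prod_of_translations l hT)
    ((translation_prod_of_translations hx l hT).trans hsum)⟩

lemma sum_map_eq_zero_of_isProductOne {G K : Type*} [Group G] [Field K]
    {r : G →* K} {x : G → K} (hx : ∀ g h, x (g * h) = x g + r g * x h)
    (T : Multiset G) (hT : ∀ g ∈ T, r g = 1) (h : IsProductOne T) : (T.map x).sum = 0 := by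
  obtain ⟨l, rfl, hl⟩ := h
  rw [Multiset.map_coe, Multiset.sum_coe, ← translation_prod_of_translations hx l hT, hl,
    translation_one hx]

/-- Among `2 * q - 1` translations of `ZMod q` there are `q` with product one. -/
lemma exists_isProductOne_of_translations {q : ℕ} (hq : q.Prime) {G : Type*} [Group G]
    {r : G →* ZMod q} {x : G → ZMod q} (hx : ∀ g h, x (g * h) = x g + r g * x h)
    (hinj : ∀ g, r g = 1 → x g = 0 → g = 1) (T : Multiset G) (hT : ∀ g ∈ T, r g = 1)
    (hcard : 2 * q - 1 ≤ T.card) : ∃ X ≤ T, X.card = q ∧ IsProductOne X := by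
  classical
  have : Fact q.Prime := ⟨hq⟩
  obtain ⟨t, hts, ht, hsum⟩ := ZMod.erdos_ginzburg_ziv (s := T.toEnumFinset) (fun z => x z.1)
    (by simpa using hcard)
  have hle : t.1.map Prod.fst ≤ T := Multiset.map_fst_le_of_subset_toEnumFinset hts
  refine ⟨t.1.map Prod.fst, hle, by simpa using ht,
    isProductOne_of_translations hx hinj _ (fun g hg => hT g (Multiset.mem_of_le hle hg)) ?_⟩
  rw [Multiset.map_map]
  exact hsum

/-- An atom with at least `2 * q - 1` translations and at most two further terms is no longer
than `q`. -/
lemma card_le_of_isMinimalProductOne {q : ℕ} (hq : q.Prime) {G : Type*} [Group G]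
    (r : G →* ZMod q) (x : G → ZMod q) (hx : ∀ g h, x (g * h) = x g + r g * x h)
    (hinj : ∀ g, r g = 1 → x g = 0 → g = 1) (T W : Multiset G) (hT : ∀ g ∈ T, r g = 1)
    (hW : ∀ g ∈ W, r g ≠ 1) (hTcard : 2 * q - 1 ≤ T.card) (hWcard : W.card ≤ 2)
    (hS : IsMinimalProductOne (T + W)) : (T + W).card ≤ q := by
  have : Fact q.Prime := ⟨hq⟩
  by_contra! hlt
  obtain ⟨X, hXT, hXcard, hX⟩ := exists_isProductOne_of_translations hq hx hinj T hT hTcard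
  obtain ⟨V, rfl⟩ := Multiset.le_iff_exists_add.mp hXT
  have hXne : X ≠ 0 := by
    rintro rfl
    exact hq.ne_zero (by simpa using hXcard.symm)
  have hV : ∀ g ∈ V, r g = 1 := fun g hg => hT g (by simp [hg])
  rw [Multiset.card_add] at hTcard
  rcases Nat.eq_zero_or_pos W.card with h0 | h0
  · rw [Multiset.card_eq_zero] at h0
    subst h0
    rw [add_zero] at hS hlt
    refine hS.2.2 ⟨X, V, hXne, ?_, rfl, hX, isProductOne_of_translations hx hinj V hV ?_⟩
    · rintro rfl
      simp [hXcard] at hlt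
    · have h1 := sum_map_eq_zero_of_isProductOne hx _ hT hS.2.1
      rw [Multiset.map_add, Multiset.sum_add, sum_map_eq_zero_of_isProductOne hx X
        (fun g hg => hT g (by simp [hg])) hX, zero_add] at h1
      exact h1
  · have hprod := prod_map_eq_one_of_isProductOne r hS.2.1
    rw [Multiset.map_add, Multiset.prod_add, Multiset.prod_eq_one (s := Multiset.map r (X + V))
      (Multiset.forall_mem_map_iff.mpr hT), one_mul] at hprod
    have hW2 : W.card = 2 := by
      by_contra hne
      obtain ⟨w, rfl⟩ := Multiset.card_eq_one.mp (show W.card = 1 by omega)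
      exact hW w (by simp) (by simpa using hprod)
    obtain ⟨w₁, w₂, rfl⟩ := Multiset.card_eq_two.mp hW2
    refine not_isMinimalProductOne_of_many_translations hq r x hx hinj w₁ w₂ V 0 X hV ?_ hXne hX ?_
    · have hne : r w₁ ≠ 1 := hW w₁ (by simp)
      have h2 : 2 ≤ ({1, r w₁, r w₁ * r w₂} : Finset (ZMod q)).card := by
        rw [← Finset.card_pair hne.symm]
        refine Finset.card_le_card ?_
        intro y hy
        simp only [Finset.mem_insert, Finset.mem_singleton] at hy ⊢
        tauto
      calc q ≤ V.card * 1 + 1 := by omega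
        _ ≤ _ := by gcongr; omega
    · convert hS using 1
      simp only [Multiset.insert_eq_cons, ← Multiset.singleton_add]
      abel

open scoped Classical in
theorem stmt14 (p q : ℕ) (hp : p.Prime) (hq : q.Prime) (hpodd : Odd p)
    (hqodd : Odd q) (hpq : p ∣ q - 1)
    (G : Type*) [Group G] [Finite G] (hG : Nat.card G = p * q)
    (hna : ¬ ∀ a b : G, a * b = b * a)
    (S : Multiset G) (hS : IsMinimalProductOne S)
    (hlen : 2 * q + 1 ≤ Multiset.card S) :
    Multiset.card (S.filter (fun g => g ∈ commutator G)) ≤ (q - 3) / 2 := by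
  obtain ⟨n, rfl⟩ : ∃ n, q = 2 * n + 1 := hqodd
  have hpn : p ≤ n := by
    have hn : n ≠ 0 := by rintro rfl; exact hq.ne_one rfl
    refine Nat.le_of_dvd (Nat.pos_of_ne_zero hn) ?_
    rw [Nat.add_sub_cancel] at hpq
    exact (Nat.Coprime.dvd_of_dvd_mul_left (Nat.coprime_two_right.mpr hpodd) hpq)
  have hlt : p < 2 * n + 1 := by omega
  obtain ⟨r, x, hx, hrmem, hinj, hr⟩ := exists_affine_coordinates hp hq hlt hG hna
  have : Fact (2 * n + 1).Prime := ⟨hq⟩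
  simp only [← hrmem]
  by_contra! hcon
  have hTn : n ≤ (S.filter fun g => r g = 1).card := by omega
  have hsplit := Multiset.filter_add_not (fun g => r g = 1) S
  have hT : ∀ g ∈ S.filter (fun g => r g = 1), r g = 1 := fun g hg => (Multiset.mem_filter.mp hg).2
  have hW : ∀ g ∈ S.filter (fun g => ¬ r g = 1), r g ≠ 1 :=
    fun g hg => (Multiset.mem_filter.mp hg).2
  generalize S.filter (fun g => r g = 1) = T at *
  generalize S.filter (fun g => ¬ r g = 1) = W at *
  subst hsplit
  rcases Nat.lt_or_ge W.card 3 with hWcard | hWcard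
  · rw [Multiset.card_add] at hlen
    have := card_le_of_isMinimalProductOne hq r x hx hinj T W hT hW (by omega) (by omega) hS
    rw [Multiset.card_add] at this
    omega
  · obtain ⟨w₁, w₂, V, rfl, hw⟩ := exists_pair_mul_ne_one r hpodd hr W hW hWcard
    obtain ⟨T₁, hT₁, hT₁card⟩ := Multiset.exists_le_card_eq_of_le_card hTn
    obtain ⟨T₂, rfl⟩ := Multiset.le_iff_exists_add.mp hT₁
    simp only [Multiset.card_add, Multiset.card_cons] at hlen
    obtain ⟨t, htsub, htne, htprod⟩ := exists_sublist_prod_eq_one hp hq hlt r x hx hinj hr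
      (T₂ + V).toList (by simp; omega)
    have hXle : (t : Multiset G) ≤ T₂ + V := by
      rw [← Multiset.coe_toList (T₂ + V), Multiset.coe_le]
      exact htsub.subperm
    obtain ⟨U, hU⟩ := Multiset.le_iff_exists_add.mp hXle
    refine not_isMinimalProductOne_of_many_translations hq r x hx hinj w₁ w₂ T₁ U t
      (fun g hg => hT g (by simp [hg])) ?_ (by simpa using htne) ⟨t, rfl, htprod⟩ ?_
    · have h1 : r w₁ ≠ 1 := hW w₁ (by simp)
      have h2 : r w₂ ≠ 1 := hW w₂ (by simp)
      have h0 : r w₁ ≠ 0 := fun h => by simpa [h, hp.ne_zero] using hr w₁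
      have h3 : ({1, r w₁, r w₁ * r w₂} : Finset (ZMod (2 * n + 1))).card = 3 := by
        refine Finset.card_eq_three.mpr ⟨_, _, _, h1.symm, hw.symm, fun h => h2 ?_, rfl⟩
        exact mul_left_cancel₀ h0 (by rw [mul_one]; exact h.symm)
      rw [h3]
      omega
    · convert hS using 1
      have : T₁ + T₂ + w₁ ::ₘ w₂ ::ₘ V = w₁ ::ₘ w₂ ::ₘ T₁ + (T₂ + V) := by
        simp only [← Multiset.singleton_add]
        abel
      rw [this, hU]
      simp only [← Multiset.singleton_add]
      abel
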